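/- arXiv:0709.2977 — 9 statements merged into one kernel-verified Lean document; each statement's English description precedes it below -/
import Mathlib

section
/- On R^3 with coordinates (x, y, z), let X1 F = cos(z) dF/dx + sin(z) dF/dy and X2 F = dF/dz for a smooth F: R^3 -> R. For constants B, C in R, the function F(x,y,z) = y - x - B(sin z + cos z) - C satisfies identically on all of R^3 the minimal surface equation of E_2: X1(X1 F) * (X2 F)^2 + X2(X2 F) * (X1 F)^2 - (X1 F)(X2 F) * ( X1(X2 F) + X2(X1 F) ) = 0. Hence every level surface {F = const} is a sub-Riemannian minimal surface of the group of roto-translations away from its characteristic points. -/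
/-- The directional derivative along `X1 = cos z ∂/∂x + sin z ∂/∂y` on `E_2 = ℝ³`. -/
noncomputable def E2X1 (F : ℝ → ℝ → ℝ → ℝ) : ℝ → ℝ → ℝ → ℝ :=
  fun x y z =>
    Real.cos z * deriv (fun x' => F x' y z) x + Real.sin z * deriv (fun y' => F x y' z) y

/-- The directional derivative along `X2 = ∂/∂z` on `E_2 = ℝ³`. -/
noncomputable def E2X2 (F : ℝ → ℝ → ℝ → ℝ) : ℝ → ℝ → ℝ → ℝ :=
  fun x y z => deriv (fun z' => F x y z') z

/-- `X1` annihilates every function of `z` alone. -/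
theorem E2X1_of_fun_z (g : ℝ → ℝ) : E2X1 (fun _ _ z => g z) = fun _ _ _ => 0 := by
  funext x y z
  simp [E2X1]

theorem E2X1_family_a (B C : ℝ) :
    E2X1 (fun x y z => y - x - B * (Real.sin z + Real.cos z) - C)
      = fun _ _ z => Real.sin z - Real.cos z := by
  funext x y z
  have hx : HasDerivAt (fun x' => y - x' - B * (Real.sin z + Real.cos z) - C) (-1) x :=
    (((hasDerivAt_id x).const_sub y).sub_const _).sub_const C
  have hy : HasDerivAt (fun y' => y' - x - B * (Real.sin z + Real.cos z) - C) 1 y :=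
    (((hasDerivAt_id y).sub_const x).sub_const _).sub_const C
  simp only [E2X1, hx.deriv, hy.deriv]
  ring

theorem E2X2_family_a (B C : ℝ) :
    E2X2 (fun x y z => y - x - B * (Real.sin z + Real.cos z) - C)
      = fun _ _ z => B * (Real.sin z - Real.cos z) := by
  funext x y z
  have hz : HasDerivAt (fun z' => y - x - B * (Real.sin z' + Real.cos z') - C)
      (-(B * (Real.cos z + -Real.sin z))) z :=
    ((((Real.hasDerivAt_sin z).add (Real.hasDerivAt_cos z)).const_mul B).const_sub
      (y - x)).sub_const C
  simp only [E2X2, hz.deriv]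
  ring

theorem E2X2_const_mul_sin_sub_cos (a : ℝ) :
    E2X2 (fun _ _ z => a * (Real.sin z - Real.cos z))
      = fun _ _ z => a * (Real.cos z + Real.sin z) := by
  funext x y z
  have hz : HasDerivAt (fun z' => a * (Real.sin z' - Real.cos z'))
      (a * (Real.cos z - -Real.sin z)) z :=
    ((Real.hasDerivAt_sin z).sub (Real.hasDerivAt_cos z)).const_mul a
  simp only [E2X2, hz.deriv]
  ring

/-- `F(x,y,z) = y - x - B(sin z + cos z) - C` satisfies identically the
minimal surface equation of the group of roto-translations `E_2`, hence its level
surfaces are sub-Riemannian minimal surfaces of `E_2` away from characteristic points. -/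
theorem e2_minimal_surface_family_a (B C : ℝ) :
    ∀ x y z : ℝ,
      E2X1 (E2X1 (fun x y z => y - x - B * (Real.sin z + Real.cos z) - C)) x y z
          * (E2X2 (fun x y z => y - x - B * (Real.sin z + Real.cos z) - C) x y z)^2
        + E2X2 (E2X2 (fun x y z => y - x - B * (Real.sin z + Real.cos z) - C)) x y z
          * (E2X1 (fun x y z => y - x - B * (Real.sin z + Real.cos z) - C) x y z)^2
        - (E2X1 (fun x y z => y - x - B * (Real.sin z + Real.cos z) - C) x y z)
          * (E2X2 (fun x y z => y - x - B * (Real.sin z + Real.cos z) - C) x y z)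
          * (E2X1 (E2X2 (fun x y z => y - x - B * (Real.sin z + Real.cos z) - C)) x y z
             + E2X2 (E2X1 (fun x y z => y - x - B * (Real.sin z + Real.cos z) - C)) x y z)
        = 0 := by
  intro x y z
  have h := E2X2_const_mul_sin_sub_cos 1
  simp only [one_mul] at h
  rw [E2X1_family_a, E2X2_family_a, E2X1_of_fun_z, E2X1_of_fun_z,
    E2X2_const_mul_sin_sub_cos, h]
  ring
end

section
/- On R^3 with coordinates (x, y, z), let X1 F = cos(z) dF/dx + sin(z) dF/dy and X2 F = dF/dz for a smooth F: R^3 -> R. For constants A, B, C in R, the function F(x,y,z) = A x + B sin(z) - C satisfies identically on all of R^3 the minimal surface equation of E_2: X1(X1 F) * (X2 F)^2 + X2(X2 F) * (X1 F)^2 - (X1 F)(X2 F) * ( X1(X2 F) + X2(X1 F) ) = 0. Hence every level surface {F = const} is a sub-Riemannian minimal surface of the group of roto-translations away from its characteristic points. -/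
theorem E2X1_linear_add_sin (A B C : ℝ) :
    E2X1 (fun x _ z => A * x + B * Real.sin z - C) = fun _ _ z => A * Real.cos z := by
  funext x y z
  simp [E2X1, mul_comm]

theorem E2X2_linear_add_sin (A B C : ℝ) :
    E2X2 (fun x _ z => A * x + B * Real.sin z - C) = fun _ _ z => B * Real.cos z := by
  funext x y z
  simp [E2X2]

theorem E2X1_mul_cos (A : ℝ) : E2X1 (fun _ _ z => A * Real.cos z) = fun _ _ _ => 0 := by
  funext x y z
  simp [E2X1]

theorem E2X2_mul_cos (A : ℝ) :
    E2X2 (fun _ _ z => A * Real.cos z) = fun _ _ z => -(A * Real.sin z) := by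
  funext x y z
  simp [E2X2]

/-- `F(x,y,z) = A x + B sin z - C` satisfies identically the minimal
surface equation of the group of roto-translations `E_2`, hence its level surfaces are
sub-Riemannian minimal surfaces of `E_2` away from characteristic points. -/
theorem e2_minimal_surface_family_b (A B C : ℝ) :
    ∀ x y z : ℝ,
      E2X1 (E2X1 (fun x _ z => A * x + B * Real.sin z - C)) x y z
          * (E2X2 (fun x _ z => A * x + B * Real.sin z - C) x y z)^2
        + E2X2 (E2X2 (fun x _ z => A * x + B * Real.sin z - C)) x y z
          * (E2X1 (fun x _ z => A * x + B * Real.sin z - C) x y z)^2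
        - (E2X1 (fun x _ z => A * x + B * Real.sin z - C) x y z)
          * (E2X2 (fun x _ z => A * x + B * Real.sin z - C) x y z)
          * (E2X1 (E2X2 (fun x _ z => A * x + B * Real.sin z - C)) x y z
             + E2X2 (E2X1 (fun x _ z => A * x + B * Real.sin z - C)) x y z)
        = 0 := by
  intro x y z
  rw [E2X1_linear_add_sin, E2X2_linear_add_sin, E2X1_mul_cos, E2X1_mul_cos, E2X2_mul_cos,
    E2X2_mul_cos]
  ring
end

section
/- On R^3 with coordinates (x, y, z), let X1 F = cos(z) dF/dx + sin(z) dF/dy and X2 F = dF/dz for a smooth F: R^3 -> R. For the function F(x,y,z) = x cos(z) + y sin(z): (a) X1 F = 1 at every point of R^3, so the level surface {F = 0} has no characteristic points; (b) at every point q of R^3, X1(X1 F)(q) * (X2 F)(q)^2 + X2(X2 F)(q) * (X1 F)(q)^2 - (X1 F)(q)(X2 F)(q) * ( X1(X2 F)(q) + X2(X1 F)(q) ) = -F(q); consequently the minimal surface equation of E_2 holds at every point of the surface {F = 0}, which is therefore a sub-Riemannian minimal surface of the group of roto-translations. -/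
/-- The function `F(x,y,z) = x cos z + y sin z` whose zero set is the minimal surface
of Example (c) in `E_2`. -/
noncomputable def F6 : ℝ → ℝ → ℝ → ℝ := fun x y z => x * Real.cos z + y * Real.sin z

theorem E2X1_linear (a b : ℝ → ℝ) :
    E2X1 (fun x y z => x * a z + y * b z) =
      fun _ _ z => Real.cos z * a z + Real.sin z * b z := by
  funext x y z
  simp [E2X1]

theorem E2X1_const (c : ℝ) : E2X1 (fun _ _ _ => c) = fun _ _ _ => 0 := by
  funext x y z
  simp [E2X1]

theorem E2X2_const (c : ℝ) : E2X2 (fun _ _ _ => c) = fun _ _ _ => 0 := by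
  funext x y z
  simp [E2X2]

theorem E2X2_linear {a b a' b' : ℝ → ℝ} (ha : ∀ z, HasDerivAt a (a' z) z)
    (hb : ∀ z, HasDerivAt b (b' z) z) :
    E2X2 (fun x y z => x * a z + y * b z) = fun x y z => x * a' z + y * b' z := by
  funext x y z
  exact (((ha z).const_mul x).add ((hb z).const_mul y)).deriv

theorem E2X1_F6 : E2X1 F6 = fun _ _ _ => 1 := by
  unfold F6
  rw [E2X1_linear]
  funext _ _ z
  linear_combination Real.sin_sq_add_cos_sq z

theorem E2X2_F6 : E2X2 F6 = fun x y z => x * -Real.sin z + y * Real.cos z :=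
  E2X2_linear Real.hasDerivAt_cos Real.hasDerivAt_sin

theorem E2X1_E2X2_F6 : E2X1 (E2X2 F6) = fun _ _ _ => 0 := by
  rw [E2X2_F6, E2X1_linear (fun z => -Real.sin z)]
  funext _ _ z
  ring

theorem E2X2_E2X2_F6 : E2X2 (E2X2 F6) = fun x y z => -F6 x y z := by
  rw [E2X2_F6,
    E2X2_linear (a := fun z => -Real.sin z) (fun z => (Real.hasDerivAt_sin z).neg) Real.hasDerivAt_cos]
  funext x y z
  unfold F6
  ring

theorem E2_minimal_operator_F6 (x y z : ℝ) :
    E2X1 (E2X1 F6) x y z * (E2X2 F6 x y z)^2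
      + E2X2 (E2X2 F6) x y z * (E2X1 F6 x y z)^2
      - (E2X1 F6 x y z) * (E2X2 F6 x y z)
        * (E2X1 (E2X2 F6) x y z + E2X2 (E2X1 F6) x y z)
      = -(F6 x y z) := by
  rw [E2X1_E2X2_F6, E2X2_E2X2_F6, E2X1_F6, E2X1_const, E2X2_const]
  ring

/-- for `F(x,y,z) = x cos z + y sin z`: (a) `X1 F = 1` everywhere, so
`{F = 0}` has no characteristic points; (b) the minimal-surface operator applied to `F`
equals `-F` at every point; consequently the minimal surface equation of `E_2` holds at
every point of `{F = 0}`, which is therefore a sub-Riemannian minimal surface. -/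
theorem e2_minimal_surface_family_c :
    (∀ x y z : ℝ, E2X1 F6 x y z = 1) ∧
    (∀ x y z : ℝ,
      E2X1 (E2X1 F6) x y z * (E2X2 F6 x y z)^2
        + E2X2 (E2X2 F6) x y z * (E2X1 F6 x y z)^2
        - (E2X1 F6 x y z) * (E2X2 F6 x y z)
          * (E2X1 (E2X2 F6) x y z + E2X2 (E2X1 F6) x y z)
        = -(F6 x y z)) ∧
    (∀ x y z : ℝ, F6 x y z = 0 →
      E2X1 (E2X1 F6) x y z * (E2X2 F6 x y z)^2
        + E2X2 (E2X2 F6) x y z * (E2X1 F6 x y z)^2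
        - (E2X1 F6 x y z) * (E2X2 F6 x y z)
          * (E2X1 (E2X2 F6) x y z + E2X2 (E2X1 F6) x y z)
        = 0) := by
  refine ⟨fun x y z => by rw [E2X1_F6], E2_minimal_operator_F6, fun x y z h => ?_⟩
  rw [E2_minimal_operator_F6, h, neg_zero]
end

section
/- Let x0, y0, z0, phi: R -> R be smooth and define q: R^2 -> R^3 by q(t,s) = ( t cos(phi(s)) + x0(s), t sin(phi(s)) + y0(s), (t/2)( x0(s) sin(phi(s)) - y0(s) cos(phi(s)) ) + z0(s) ). Let xi1(s) = x0'(s), xi2(s) = y0'(s), xi3(s) = z0'(s) - ( x0(s) y0'(s) - y0(s) x0'(s) )/2, xi4(s) = phi'(s). Then for every (t,s): (a) omega_{q(t,s)}( dq/dt (t,s) ) = 0; (b) omega_{q(t,s)}( dq/ds (t,s) ) = xi3(s) + t ( xi1(s) sin(phi(s)) - xi2(s) cos(phi(s)) ) - (t^2/2) xi4(s). Consequently q(t,s) is a characteristic point of the parametrized surface (i.e. omega vanishes on both partial derivatives) if and only if xi3(s) + t ( xi1(s) sin(phi(s)) - xi2(s) cos(phi(s)) ) - (t^2/2) xi4(s)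 = 0. -/
/-- The parametrized sub-Riemannian minimal surface of the Heisenberg group `H¹`
generated by the curve `Γ(s) = (x0(s), y0(s), z0(s), φ(s))`. -/
noncomputable def Hsurf (x0 y0 z0 phi : ℝ → ℝ) (t s : ℝ) : Fin 3 → ℝ :=
  ![t * Real.cos (phi s) + x0 s, t * Real.sin (phi s) + y0 s,
    t / 2 * (x0 s * Real.sin (phi s) - y0 s * Real.cos (phi s)) + z0 s]

/-- The contact form of the Heisenberg group `H¹`:
`ω_q(v) = v₃ - (x v₂ - y v₁)/2` for `q = (x,y,z)`. -/
noncomputable def Homega (p v : Fin 3 → ℝ) : ℝ :=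
  v 2 - (p 0 * v 1 - p 1 * v 0) / 2

theorem Homega_deriv_Hsurf_left (x0 y0 z0 phi : ℝ → ℝ) (t s : ℝ) :
    Homega (Hsurf x0 y0 z0 phi t s)
      (fun i => deriv (fun u => Hsurf x0 y0 z0 phi u s i) t) = 0 := by
  have hid := hasDerivAt_id' t
  have h0 := ((hid.mul_const (Real.cos (phi s))).add_const (x0 s)).deriv
  have h1 := ((hid.mul_const (Real.sin (phi s))).add_const (y0 s)).deriv
  have h2 := (((hid.div_const 2).mul_const
    (x0 s * Real.sin (phi s) - y0 s * Real.cos (phi s))).add_const (z0 s)).deriv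
  simp only [Homega, Hsurf, Matrix.cons_val] at h0 h1 h2 ⊢
  rw [h0, h1, h2]
  ring

theorem Homega_deriv_Hsurf_right {x0 y0 z0 phi : ℝ → ℝ} {s : ℝ}
    (hx0 : DifferentiableAt ℝ x0 s) (hy0 : DifferentiableAt ℝ y0 s)
    (hz0 : DifferentiableAt ℝ z0 s) (hphi : DifferentiableAt ℝ phi s) (t : ℝ) :
    Homega (Hsurf x0 y0 z0 phi t s)
        (fun i => deriv (fun u => Hsurf x0 y0 z0 phi t u i) s)
      = (deriv z0 s - (x0 s * deriv y0 s - y0 s * deriv x0 s) / 2)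
        + t * (deriv x0 s * Real.sin (phi s) - deriv y0 s * Real.cos (phi s))
        - t^2 / 2 * deriv phi s := by
  have hc := hphi.hasDerivAt.cos
  have hs := hphi.hasDerivAt.sin
  have h0 := ((hc.const_mul t).fun_add hx0.hasDerivAt).deriv
  have h1 := ((hs.const_mul t).fun_add hy0.hasDerivAt).deriv
  have h2 := ((((hx0.hasDerivAt.fun_mul hs).fun_sub
    (hy0.hasDerivAt.fun_mul hc)).const_mul (t / 2)).fun_add hz0.hasDerivAt).deriv
  simp only [Homega, Hsurf, Matrix.cons_val] at h0 h1 h2 ⊢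
  rw [h0, h1, h2]
  linear_combination (-(t ^ 2 / 2) * deriv phi s) * Real.sin_sq_add_cos_sq (phi s)

/-- for the Heisenberg minimal surface generated by
`Γ(s) = (x0(s), y0(s), z0(s), φ(s))`, with frame components
`ξ1 = x0'`, `ξ2 = y0'`, `ξ3 = z0' - (x0 y0' - y0 x0')/2`, `ξ4 = φ'`:
(a) `ω` annihilates `∂q/∂t`; (b) `ω(∂q/∂s) = ξ3 + t(ξ1 sin φ - ξ2 cos φ) - (t²/2) ξ4`;
hence `q(t,s)` is a characteristic point iff this quadratic expression in `t` vanishes. -/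
theorem heisenberg_characteristic_points_quadratic
    (x0 y0 z0 phi : ℝ → ℝ)
    (hx0 : ContDiff ℝ (⊤ : ℕ∞) x0) (hy0 : ContDiff ℝ (⊤ : ℕ∞) y0)
    (hz0 : ContDiff ℝ (⊤ : ℕ∞) z0) (hphi : ContDiff ℝ (⊤ : ℕ∞) phi)
    (t s : ℝ) :
    Homega (Hsurf x0 y0 z0 phi t s)
        (fun i => deriv (fun u => Hsurf x0 y0 z0 phi u s i) t) = 0 ∧
    Homega (Hsurf x0 y0 z0 phi t s)
        (fun i => deriv (fun u => Hsurf x0 y0 z0 phi t u i) s)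
      = (deriv z0 s - (x0 s * deriv y0 s - y0 s * deriv x0 s) / 2)
        + t * (deriv x0 s * Real.sin (phi s) - deriv y0 s * Real.cos (phi s))
        - t^2 / 2 * deriv phi s ∧
    ((Homega (Hsurf x0 y0 z0 phi t s)
        (fun i => deriv (fun u => Hsurf x0 y0 z0 phi u s i) t) = 0 ∧
      Homega (Hsurf x0 y0 z0 phi t s)
        (fun i => deriv (fun u => Hsurf x0 y0 z0 phi t u i) s) = 0) ↔
      (deriv z0 s - (x0 s * deriv y0 s - y0 s * deriv x0 s) / 2)
        + t * (deriv x0 s * Real.sin (phi s) - deriv y0 s * Real.cos (phi s))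
        - t^2 / 2 * deriv phi s = 0) := by
  have left := Homega_deriv_Hsurf_left x0 y0 z0 phi t s
  have right := Homega_deriv_Hsurf_right
    (hx0.differentiable (by simp) s) (hy0.differentiable (by simp) s)
    (hz0.differentiable (by simp) s) (hphi.differentiable (by simp) s) t
  refine ⟨left, right, ?_⟩
  rw [← right]
  exact and_iff_right left
end

section
/- Let x0, y0, z0, phi: R -> R be smooth and define q: R^2 -> R^3 by q(t,s) = ( t cos(phi(s)) + x0(s), t sin(phi(s)) + y0(s), (t/2)( x0(s) sin(phi(s)) - y0(s) cos(phi(s)) ) + z0(s) ). Let xi1 = x0', xi2 = y0', xi3 = z0' - ( x0 y0' - y0 x0' )/2, xi4 = phi', and D(s) = ( xi1(s) sin(phi(s)) - xi2(s) cos(phi(s)) )^2 + 2 xi3(s) xi4(s). Assume the nondegeneracy condition: for every s, it is not the case that xi3(s) = 0, xi4(s) = 0 and xi1(s) sin(phi(s)) - xi2(s) cos(phi(s)) = 0 simultaneously. Then the total derivative Dq(t,s): R^2 -> R^3 has rank strictly less than 2 at (t,s) if and only if xi4(s) is nonzero, D(s) = 0, and t = ( xi1(s) sin(phi(s)) - xi2(s)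 cos(phi(s)) ) / xi4(s). -/
theorem not_linearIndependent_pair_iff_of_sq_add_sq_eq_one {c d m p q r : ℝ}
    (h : c ^ 2 + d ^ 2 = 1) :
    ¬ LinearIndependent ℝ ![![c, d, m], ![p, q, r]] ↔
      p * d - q * c = 0 ∧ r = m * (c * p + d * q) := by
  have hne : ![c, d, m] ≠ 0 := by
    intro h0
    have hc : c = 0 := congrFun h0 0
    have hd : d = 0 := congrFun h0 1
    simp [hc, hd] at h
  rw [LinearIndependent.pair_iff' hne]
  push Not
  constructor
  · rintro ⟨a, ha⟩
    have hp : a * c = p := congrFun ha 0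
    have hq : a * d = q := congrFun ha 1
    have hr : a * m = r := congrFun ha 2
    subst hp hq hr
    exact ⟨by ring, by linear_combination (-a * m) * h⟩
  · rintro ⟨h1, h2⟩
    refine ⟨c * p + d * q, ?_⟩
    ext i
    fin_cases i
    · change (c * p + d * q) * c = p
      linear_combination p * h - d * h1
    · change (c * p + d * q) * d = q
      linear_combination q * h + c * h1
    · change (c * p + d * q) * m = r
      linear_combination -h2

theorem deriv_Hsurf_fst (x0 y0 z0 phi : ℝ → ℝ) (t s : ℝ) :
    (fun i => deriv (fun u => Hsurf x0 y0 z0 phi u s i) t) =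
      ![Real.cos (phi s), Real.sin (phi s),
        (x0 s * Real.sin (phi s) - y0 s * Real.cos (phi s)) / 2] := by
  ext i
  fin_cases i <;> simp [Hsurf]
  ring

theorem deriv_Hsurf_snd {x0 y0 z0 phi : ℝ → ℝ} (t : ℝ) {s : ℝ}
    (hx : DifferentiableAt ℝ x0 s) (hy : DifferentiableAt ℝ y0 s)
    (hz : DifferentiableAt ℝ z0 s) (hphi : DifferentiableAt ℝ phi s) :
    (fun i => deriv (fun u => Hsurf x0 y0 z0 phi t u i) s) =
      ![deriv x0 s - t * deriv phi s * Real.sin (phi s),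
        deriv y0 s + t * deriv phi s * Real.cos (phi s),
        t / 2 * (deriv x0 s * Real.sin (phi s) - deriv y0 s * Real.cos (phi s)
          + deriv phi s * (x0 s * Real.cos (phi s) + y0 s * Real.sin (phi s))) + deriv z0 s] := by
  have hc := hphi.hasDerivAt.cos
  have hs := hphi.hasDerivAt.sin
  ext i
  fin_cases i
  · exact ((hc.const_mul t).add hx.hasDerivAt).deriv.trans (by simp; ring)
  · exact ((hs.const_mul t).add hy.hasDerivAt).deriv.trans (by simp; ring)
  · exact ((((hx.hasDerivAt.mul hs).sub (hy.hasDerivAt.mul hc)).const_mul (t / 2)).add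
      hz.hasDerivAt).deriv.trans (by simp only [Fin.reduceFinMk, Matrix.cons_val]; ring)

/-- with frame components `ξ1 = x0'`, `ξ2 = y0'`,
`ξ3 = z0' - (x0 y0' - y0 x0')/2`, `ξ4 = φ'` and discriminant
`D = (ξ1 sin φ - ξ2 cos φ)² + 2 ξ3 ξ4`, under the nondegeneracy condition that
`ξ3, ξ4` and `ξ1 sin φ - ξ2 cos φ` never vanish simultaneously, the total derivative of
the parametrization has rank `< 2` at `(t,s)` iff `ξ4(s) ≠ 0`, `D(s) = 0` and
`t = (ξ1(s) sin φ(s) - ξ2(s) cos φ(s)) / ξ4(s)` (Proposition 3 of the paper). -/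
theorem heisenberg_singular_points_characterization
    (x0 y0 z0 phi : ℝ → ℝ)
    (hx0 : ContDiff ℝ (⊤ : ℕ∞) x0) (hy0 : ContDiff ℝ (⊤ : ℕ∞) y0)
    (hz0 : ContDiff ℝ (⊤ : ℕ∞) z0) (hphi : ContDiff ℝ (⊤ : ℕ∞) phi)
    (hnd : ∀ s : ℝ, ¬ (deriv z0 s - (x0 s * deriv y0 s - y0 s * deriv x0 s) / 2 = 0 ∧
        deriv phi s = 0 ∧
        deriv x0 s * Real.sin (phi s) - deriv y0 s * Real.cos (phi s) = 0))
    (t s : ℝ) :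
    ¬ LinearIndependent ℝ
        ![(fun i => deriv (fun u => Hsurf x0 y0 z0 phi u s i) t),
          (fun i => deriv (fun u => Hsurf x0 y0 z0 phi t u i) s)] ↔
      (deriv phi s ≠ 0 ∧
       (deriv x0 s * Real.sin (phi s) - deriv y0 s * Real.cos (phi s))^2
         + 2 * (deriv z0 s - (x0 s * deriv y0 s - y0 s * deriv x0 s) / 2) * deriv phi s = 0 ∧
       t = (deriv x0 s * Real.sin (phi s) - deriv y0 s * Real.cos (phi s)) / deriv phi s) := by
  have hone := Real.cos_sq_add_sin_sq (phi s)
  have hs := hnd s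
  rw [deriv_Hsurf_fst, deriv_Hsurf_snd t (hx0.differentiable (by simp) s)
    (hy0.differentiable (by simp) s) (hz0.differentiable (by simp) s)
    (hphi.differentiable (by simp) s),
    not_linearIndependent_pair_iff_of_sq_add_sq_eq_one hone]
  generalize Real.cos (phi s) = c at *
  generalize Real.sin (phi s) = d at *
  generalize deriv x0 s = a at *
  generalize deriv y0 s = b at *
  generalize deriv z0 s = e at *
  generalize deriv phi s = f at *
  generalize x0 s = x at *
  generalize y0 s = y at *
  have h1 : (a - t * f * d) * d - (b + t * f * c) * c = a * d - b * c - t * f := by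
    linear_combination (-t * f) * hone
  have h2 : t / 2 * (a * d - b * c + f * (x * c + y * d)) + e
      - (x * d - y * c) / 2 * (c * (a - t * f * d) + d * (b + t * f * c)) =
      (e - (x * b - y * a) / 2) + t / 2 * (a * d - b * c)
        - (a * d - b * c - t * f) * (x * c + y * d) / 2 := by
    linear_combination (-(x * b - y * a) / 2) * hone
  rw [h1, ← sub_eq_zero (b := _ * (c * _ + d * _)), h2]
  generalize a * d - b * c = F at *
  generalize e - (x * b - y * a) / 2 = k at *
  constructor
  · rintro ⟨hF, hk⟩
    rw [hF, zero_mul, zero_div, sub_zero] at hk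
    have hf : f ≠ 0 := by
      rintro rfl
      have hF0 : F = 0 := by linear_combination hF
      subst hF0
      exact hs ⟨by linear_combination hk, rfl, rfl⟩
    refine ⟨hf, by linear_combination F * hF + 2 * f * hk, ?_⟩
    rw [eq_div_iff hf]
    linear_combination -hF
  · rintro ⟨hf, hD, ht⟩
    rw [eq_div_iff hf] at ht
    have hF : F - t * f = 0 := by linear_combination -ht
    refine ⟨hF, ?_⟩
    rw [hF, zero_mul, zero_div, sub_zero]
    refine (mul_eq_zero.mp ?_).resolve_left (mul_ne_zero two_ne_zero hf)
    linear_combination hD - F * hF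
end

section
/- Define q: R^2 -> R^3 by q(t,s) = ( t cos(s), t sin(s), s ) (the counter-clockwise helicoid in the Heisenberg group). Then: (a) omega_{q(t,s)}( dq/dt (t,s) ) = 0 and omega_{q(t,s)}( dq/ds (t,s) ) = 1 - t^2/2 for all (t,s); hence q(t,s) is a characteristic point if and only if t = sqrt(2) or t = -sqrt(2), and the singular set of the helicoid is the union of the two disjoint curves s -> ( sqrt(2) cos s, sqrt(2) sin s, s ) and s -> ( -sqrt(2) cos s, -sqrt(2) sin s, s ); (b) the total derivative Dq(t,s): R^2 -> R^3 has rank 2 at every (t,s), so all characteristic points are regular and the two curves are simple singular curves containing no singular characteristic points. -/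
/-- The counter-clockwise helicoid in the Heisenberg group: `q(t,s) = (t cos s, t sin s, s)`. -/
noncomputable def helicoid (t s : ℝ) : Fin 3 → ℝ :=
  ![t * Real.cos s, t * Real.sin s, s]

/-- The partial derivative of the helicoid along its rulings. -/
theorem deriv_helicoid_left (t s : ℝ) :
    (fun i => deriv (fun u => helicoid u s i) t) = ![Real.cos s, Real.sin s, 0] := by
  ext i
  fin_cases i <;> simp [helicoid]

/-- The partial derivative of the helicoid in the angular parameter. -/
theorem deriv_helicoid_right (t s : ℝ) :
    (fun i => deriv (fun u => helicoid t u i) s) = ![-(t * Real.sin s), t * Real.cos s, 1] := by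
  ext i
  fin_cases i <;> simp [helicoid]

theorem Homega_deriv_helicoid_left (t s : ℝ) :
    Homega (helicoid t s) (fun i => deriv (fun u => helicoid u s i) t) = 0 := by
  rw [deriv_helicoid_left]
  simp [Homega, helicoid]
  ring

theorem Homega_deriv_helicoid_right (t s : ℝ) :
    Homega (helicoid t s) (fun i => deriv (fun u => helicoid t u i) s) = 1 - t ^ 2 / 2 := by
  rw [deriv_helicoid_right]
  simp [Homega, helicoid]
  linear_combination t ^ 2 * Real.sin_sq_add_cos_sq s

/-- for the counter-clockwise helicoid in `H¹`:
(a) `ω(∂q/∂t) = 0` and `ω(∂q/∂s) = 1 - t²/2`, so `q(t,s)` is a characteristic point iff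
`t = ±√2`, and the singular set is the union of two disjoint simple singular curves;
(b) the parametrization has rank 2 everywhere, so all characteristic points are regular. -/
theorem helicoid_singular_set :
    (∀ t s : ℝ, Homega (helicoid t s) (fun i => deriv (fun u => helicoid u s i) t) = 0) ∧
    (∀ t s : ℝ, Homega (helicoid t s) (fun i => deriv (fun u => helicoid t u i) s)
      = 1 - t^2 / 2) ∧
    (∀ t s : ℝ,
      (Homega (helicoid t s) (fun i => deriv (fun u => helicoid u s i) t) = 0 ∧
       Homega (helicoid t s) (fun i => deriv (fun u => helicoid t u i) s) = 0) ↔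
      (t = Real.sqrt 2 ∨ t = -Real.sqrt 2)) ∧
    (∀ s s' : ℝ,
      (![Real.sqrt 2 * Real.cos s, Real.sqrt 2 * Real.sin s, s] : Fin 3 → ℝ)
        ≠ ![-Real.sqrt 2 * Real.cos s', -Real.sqrt 2 * Real.sin s', s']) ∧
    (∀ t s : ℝ, LinearIndependent ℝ
      ![(fun i => deriv (fun u => helicoid u s i) t),
        (fun i => deriv (fun u => helicoid t u i) s)]) := by
  refine ⟨Homega_deriv_helicoid_left, Homega_deriv_helicoid_right, fun t s => ?_,
    fun s s' h => ?_, fun t s => ?_⟩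
  · rw [Homega_deriv_helicoid_left, Homega_deriv_helicoid_right, ← sq_eq_sq_iff_eq_or_eq_neg,
      Real.sq_sqrt zero_le_two]
    constructor
    · rintro ⟨-, h⟩
      linarith
    · intro h
      exact ⟨rfl, by linarith⟩
  · have h0 := congrFun h 0
    have h1 := congrFun h 1
    have h2 : s = s' := congrFun h 2
    subst h2
    have hpos : 0 < Real.sqrt 2 := Real.sqrt_pos.mpr two_pos
    simp only [Matrix.cons_val] at h0 h1
    have hc : Real.cos s = 0 :=
      (mul_eq_zero.mp (by linarith : Real.sqrt 2 * Real.cos s = 0)).resolve_left hpos.ne'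
    have hs : Real.sin s = 0 :=
      (mul_eq_zero.mp (by linarith : Real.sqrt 2 * Real.sin s = 0)).resolve_left hpos.ne'
    simpa [hc, hs] using Real.sin_sq_add_cos_sq s
  · rw [deriv_helicoid_left, deriv_helicoid_right, LinearIndependent.pair_iff]
    intro a b h
    have h0 := congrFun h 0
    have h1 := congrFun h 1
    have hb : b = 0 := by simpa using congrFun h 2
    subst hb
    simp at h0 h1
    refine ⟨?_, rfl⟩
    rcases h0 with ha | hc
    · exact ha
    · rcases h1 with ha | hs
      · exact ha
      · simpa [hc, hs] using Real.sin_sq_add_cos_sq s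
end

section
/- Define q: R^2 -> R^3 by q(t,s) = ( t cos(s), t sin(s), s^3/6 ) (the minimal surface of the Heisenberg group generated by the curve Gamma(s) = (0, 0, s^3/6, s)). Then: (a) omega_{q(t,s)}( dq/dt ) = 0 and omega_{q(t,s)}( dq/ds ) = (s^2 - t^2)/2 for all (t,s), so q(t,s) is a characteristic point if and only if t = s or t = -s; the singular set consists of the two simple singular curves s -> ( s cos s, s sin s, s^3/6 ) and s -> ( -s cos s, -s sin s, s^3/6 ), which meet at the origin; (b) the total derivative Dq(t,s): R^2 -> R^3 has rank strictly less than 2 if and only if (t,s) = (0,0); hence the origin is the unique singular characteristic point of this surface and the two simple singular curves touch each other there. -/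
/-- The Heisenberg minimal surface generated by `Γ(s) = (0, 0, s³/6, s)`:
`q(t,s) = (t cos s, t sin s, s³/6)`. -/
noncomputable def cubicSurf (t s : ℝ) : Fin 3 → ℝ :=
  ![t * Real.cos s, t * Real.sin s, s^3 / 6]

theorem deriv_cubicSurf_left (t s : ℝ) :
    (fun i => deriv (fun u => cubicSurf u s i) t) = ![Real.cos s, Real.sin s, 0] := by
  funext i
  fin_cases i <;> simp [cubicSurf]

theorem deriv_cubicSurf_right (t s : ℝ) :
    (fun i => deriv (fun u => cubicSurf t u i) s) =
      ![-(t * Real.sin s), t * Real.cos s, s ^ 2 / 2] := by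
  funext i
  fin_cases i
  · simp [cubicSurf]
  · simp [cubicSurf]
  · have h := ((hasDerivAt_pow 3 s).div_const 6).deriv
    simp only [cubicSurf]
    refine Eq.trans h ?_
    simp
    ring

theorem Homega_deriv_cubicSurf_left (t s : ℝ) :
    Homega (cubicSurf t s) (fun i => deriv (fun u => cubicSurf u s i) t) = 0 := by
  rw [deriv_cubicSurf_left]
  simp [Homega, cubicSurf]
  ring

theorem Homega_deriv_cubicSurf_right (t s : ℝ) :
    Homega (cubicSurf t s) (fun i => deriv (fun u => cubicSurf t u i) s)
      = (s ^ 2 - t ^ 2) / 2 := by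
  rw [deriv_cubicSurf_right]
  simp [Homega, cubicSurf]
  linear_combination (-t ^ 2 / 2) * Real.sin_sq_add_cos_sq s

theorem linearIndependent_deriv_cubicSurf {t s : ℝ} (hts : ¬ (t = 0 ∧ s = 0)) :
    LinearIndependent ℝ
      ![![Real.cos s, Real.sin s, 0], ![-(t * Real.sin s), t * Real.cos s, s ^ 2 / 2]] := by
  rw [LinearIndependent.pair_iff]
  intro a b hab
  have h0 := congrFun hab 0
  have h1 := congrFun hab 1
  have h2 := congrFun hab 2
  simp at h0 h1 h2
  have hcs := Real.sin_sq_add_cos_sq s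
  have ha : a = 0 := by
    linear_combination Real.cos s * h0 + Real.sin s * h1 - a * hcs
  have hbt : b * t = 0 := by
    linear_combination Real.cos s * h1 - Real.sin s * h0 - b * t * hcs
  refine ⟨ha, ?_⟩
  by_contra hb
  exact hts ⟨(mul_eq_zero.mp hbt).resolve_left hb, h2.resolve_left hb⟩


/-- for the surface `q(t,s) = (t cos s, t sin s, s³/6)` in `H¹`:
(a) `ω(∂q/∂t) = 0` and `ω(∂q/∂s) = (s² - t²)/2`, so `q(t,s)` is a characteristic point
iff `t = s` or `t = -s`; (b) the parametrization has rank `< 2` iff `(t,s) = (0,0)`, so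
the origin is the unique singular characteristic point, where the two simple singular
curves touch each other. -/
theorem cubic_surface_singular_set :
    (∀ t s : ℝ, Homega (cubicSurf t s) (fun i => deriv (fun u => cubicSurf u s i) t) = 0) ∧
    (∀ t s : ℝ, Homega (cubicSurf t s) (fun i => deriv (fun u => cubicSurf t u i) s)
      = (s^2 - t^2) / 2) ∧
    (∀ t s : ℝ,
      (Homega (cubicSurf t s) (fun i => deriv (fun u => cubicSurf u s i) t) = 0 ∧
       Homega (cubicSurf t s) (fun i => deriv (fun u => cubicSurf t u i) s) = 0) ↔
      (t = s ∨ t = -s)) ∧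
    (∀ t s : ℝ,
      (¬ LinearIndependent ℝ
        ![(fun i => deriv (fun u => cubicSurf u s i) t),
          (fun i => deriv (fun u => cubicSurf t u i) s)]) ↔ (t = 0 ∧ s = 0)) := by
  refine ⟨Homega_deriv_cubicSurf_left, Homega_deriv_cubicSurf_right, fun t s => ?_, fun t s => ?_⟩
  · rw [Homega_deriv_cubicSurf_left, Homega_deriv_cubicSurf_right, ← sq_eq_sq_iff_eq_or_eq_neg]
    constructor
    · rintro ⟨-, h⟩
      linarith
    · intro h
      exact ⟨rfl, by linarith⟩
  · rw [deriv_cubicSurf_left, deriv_cubicSurf_right]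
    refine ⟨fun h => not_not.mp (mt linearIndependent_deriv_cubicSurf h), ?_⟩
    rintro ⟨rfl, rfl⟩ h
    refine h.ne_zero 1 ?_
    ext i
    fin_cases i <;> simp
end

section
/- Define q: R^2 -> R^3 by q(t,s) = ( t cos(s) + sin(s), t sin(s) - cos(s), t/2 + 1 + s/2 ) (the minimal surface of the Heisenberg group generated by the curve Gamma(s) = ( sin s, -cos s, 1 + s/2, s )). Then: (a) omega_{q(t,s)}( dq/dt ) = 0 and omega_{q(t,s)}( dq/ds ) = -t^2/2 for all (t,s), so q(t,s) is a characteristic point if and only if t = 0; (b) for every s, dq/ds (0,s) = dq/dt (0,s) = ( cos s, sin s, 1/2 ), so the total derivative Dq(0,s) has rank 1 at every point of the curve t = 0. Hence the curve s -> ( sin s, -cos s, 1 + s/2 ) is a strongly singular curve: it consists entirely of singular characteristic points, it is tangent to the characteristic direction at every point, and the surface has no other characteristic points. -/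
/-- The Heisenberg minimal surface generated by `Γ(s) = (sin s, -cos s, 1 + s/2, s)`:
`q(t,s) = (t cos s + sin s, t sin s - cos s, t/2 + 1 + s/2)`. -/
noncomputable def ssSurf (t s : ℝ) : Fin 3 → ℝ :=
  ![t * Real.cos s + Real.sin s, t * Real.sin s - Real.cos s, t / 2 + 1 + s / 2]

/-- The `t`-derivative of the surface is the characteristic direction `(cos s, sin s, 1/2)`. -/
theorem deriv_ssSurf_left (t s : ℝ) :
    (fun i => deriv (fun u => ssSurf u s i) t) =
      (![Real.cos s, Real.sin s, 1 / 2] : Fin 3 → ℝ) := by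
  funext i
  apply HasDerivAt.deriv
  have hid := hasDerivAt_id t
  fin_cases i
  · simpa [ssSurf] using (hid.mul_const (Real.cos s)).add_const (Real.sin s)
  · simpa [ssSurf] using (hid.mul_const (Real.sin s)).sub_const (Real.cos s)
  · simpa [ssSurf] using ((hid.div_const 2).add_const 1).add_const (s / 2)

theorem deriv_ssSurf_right (t s : ℝ) :
    (fun i => deriv (fun u => ssSurf t u i) s) =
      (![-(t * Real.sin s) + Real.cos s, t * Real.cos s + Real.sin s, 1 / 2] :
        Fin 3 → ℝ) := by
  funext i
  apply HasDerivAt.deriv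
  have hcos := Real.hasDerivAt_cos s
  have hsin := Real.hasDerivAt_sin s
  fin_cases i
  · simpa [ssSurf] using (hcos.const_mul t).fun_add hsin
  · simpa [ssSurf] using (hsin.const_mul t).fun_sub hcos
  · simpa [ssSurf] using ((hasDerivAt_id s).div_const 2).const_add (t / 2 + 1)

theorem Homega_deriv_ssSurf_left (t s : ℝ) :
    Homega (ssSurf t s) (fun i => deriv (fun u => ssSurf u s i) t) = 0 := by
  rw [deriv_ssSurf_left]
  simp only [Homega, ssSurf, Matrix.cons_val]
  linear_combination (-1 / 2) * Real.sin_sq_add_cos_sq s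

theorem Homega_deriv_ssSurf_right (t s : ℝ) :
    Homega (ssSurf t s) (fun i => deriv (fun u => ssSurf t u i) s) = -t ^ 2 / 2 := by
  rw [deriv_ssSurf_right]
  simp only [Homega, ssSurf, Matrix.cons_val]
  linear_combination (-(1 + t ^ 2) / 2) * Real.sin_sq_add_cos_sq s

/-- for the surface `q(t,s) = (t cos s + sin s, t sin s - cos s, t/2+1+s/2)`
in `H¹`: (a) `ω(∂q/∂t) = 0` and `ω(∂q/∂s) = -t²/2`, so `q(t,s)` is a characteristic point
iff `t = 0`; (b) along `t = 0` both partial derivatives equal `(cos s, sin s, 1/2)`, so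
the parametrization has rank 1 there: the curve `s ↦ (sin s, -cos s, 1 + s/2)` is a
strongly singular curve consisting of singular characteristic points, tangent to the
characteristic direction at every point, and the surface has no other characteristic
points. -/
theorem strongly_singular_curve_example :
    (∀ t s : ℝ, Homega (ssSurf t s) (fun i => deriv (fun u => ssSurf u s i) t) = 0) ∧
    (∀ t s : ℝ, Homega (ssSurf t s) (fun i => deriv (fun u => ssSurf t u i) s)
      = -t^2 / 2) ∧
    (∀ t s : ℝ,
      (Homega (ssSurf t s) (fun i => deriv (fun u => ssSurf u s i) t) = 0 ∧
       Homega (ssSurf t s) (fun i => deriv (fun u => ssSurf t u i) s) = 0) ↔ t = 0) ∧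
    (∀ s : ℝ,
      (fun i => deriv (fun u => ssSurf 0 u i) s) = (![Real.cos s, Real.sin s, 1/2] : Fin 3 → ℝ) ∧
      (fun i => deriv (fun u => ssSurf u s i) 0) = (![Real.cos s, Real.sin s, 1/2] : Fin 3 → ℝ) ∧
      ¬ LinearIndependent ℝ
        ![(fun i => deriv (fun u => ssSurf u s i) 0),
          (fun i => deriv (fun u => ssSurf 0 u i) s)]) := by
  refine ⟨Homega_deriv_ssSurf_left, Homega_deriv_ssSurf_right, fun t s => ?_, fun s => ?_⟩
  · simp [Homega_deriv_ssSurf_left, Homega_deriv_ssSurf_right]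
  · have hs : (fun i => deriv (fun u => ssSurf 0 u i) s) =
        (![Real.cos s, Real.sin s, 1 / 2] : Fin 3 → ℝ) := by
      simp [deriv_ssSurf_right]
    refine ⟨hs, deriv_ssSurf_left 0 s, fun h => ?_⟩
    rw [hs, deriv_ssSurf_left] at h
    exact absurd (h.injective (a₁ := 0) (a₂ := 1) rfl) (by decide)
end

section
/- Let q: R^2 -> R^3 be the parametrization of the Heisenberg minimal surface generated by Gamma(s) = ( -2 cos s, -2 sin s, cos s, s ), i.e. q(t,s) = ( t cos(phi(s)) + x0(s), t sin(phi(s)) + y0(s), (t/2)( x0(s) sin(phi(s)) - y0(s) cos(phi(s)) ) + z0(s) ) with x0(s) = -2 cos s, y0(s) = -2 sin s, z0(s) = cos s, phi(s) = s. Then: (a) q(t,s) = ( (t-2) cos s, (t-2) sin s, cos s ) for all (t,s); in particular q(2, s) = (0, 0, cos s) for every s, so the surface intersects itself along the segment { (0,0,z) : -1 <= z <= 1 } joining the two points q(2,0) = (0,0,1) and q(2,pi) = (0,0,-1); (b) the frame components of Gamma' are xi1(s) = 2 sin s, xi2(s) = -2 cos s, xi3(s) = -2 - sin s, xi4(s)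 = 1, and the discriminant D(s) = ( xi1 sin(phi) - xi2 cos(phi) )^2(s) + 2 xi3(s) xi4(s) equals -2 sin s; (c) the total derivative Dq(t,s): R^2 -> R^3 has rank strictly less than 2 if and only if t = 2 and sin s = 0, so the singular characteristic points of the surface are exactly the points (0,0,1) and (0,0,-1). -/
/-- The surface of Example 4: generated by `Γ(s) = (-2 cos s, -2 sin s, cos s, s)`. -/
noncomputable def ex4Surf : ℝ → ℝ → Fin 3 → ℝ :=
  Hsurf (fun s => -2 * Real.cos s) (fun s => -2 * Real.sin s) (fun s => Real.cos s) id

theorem ex4Surf_apply (t s : ℝ) :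
    ex4Surf t s = ![(t - 2) * Real.cos s, (t - 2) * Real.sin s, Real.cos s] := by
  ext i
  fin_cases i
  · simp [ex4Surf, Hsurf]; ring
  · simp [ex4Surf, Hsurf]; ring
  · simp [ex4Surf, Hsurf]; right; ring

theorem ex4Surf_deriv_fst (t s : ℝ) :
    (fun i => deriv (fun u => ex4Surf u s i) t) = ![Real.cos s, Real.sin s, 0] := by
  ext i
  fin_cases i <;> simp [ex4Surf_apply]

theorem ex4Surf_deriv_snd (t s : ℝ) :
    (fun i => deriv (fun u => ex4Surf t u i) s)
      = ![-((t - 2) * Real.sin s), (t - 2) * Real.cos s, -Real.sin s] := by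
  ext i
  fin_cases i <;> simp [ex4Surf_apply]

theorem ex4Surf_not_linearIndependent_iff (t s : ℝ) :
    (¬ LinearIndependent ℝ
        ![(fun i => deriv (fun u => ex4Surf u s i) t),
          (fun i => deriv (fun u => ex4Surf t u i) s)]) ↔ (t = 2 ∧ Real.sin s = 0) := by
  have hsc := Real.sin_sq_add_cos_sq s
  rw [ex4Surf_deriv_fst, ex4Surf_deriv_snd, LinearIndependent.pair_iff, ← not_iff_not, not_not]
  constructor
  · rintro h ⟨rfl, hs⟩
    have := h 0 1 (by ext i; fin_cases i <;> simp [hs])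
    exact one_ne_zero this.2
  · intro h a b hab
    have h0 : a * Real.cos s + b * -((t - 2) * Real.sin s) = 0 := by
      simpa using congrFun hab 0
    have h1 : a * Real.sin s + b * ((t - 2) * Real.cos s) = 0 := by
      simpa using congrFun hab 1
    have h2 : b = 0 ∨ Real.sin s = 0 := by
      simpa using congrFun hab 2
    have ha : a = 0 := by
      linear_combination Real.cos s * h0 + Real.sin s * h1 - a * hsc
    have hbt : b * (t - 2) = 0 := by
      linear_combination -Real.sin s * h0 + Real.cos s * h1 - b * (t - 2) * hsc
    refine ⟨ha, ?_⟩
    rcases h2 with hb | hs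
    · exact hb
    · rcases mul_eq_zero.1 hbt with hb | ht
      · exact hb
      · exact absurd ⟨sub_eq_zero.1 ht, hs⟩ h

/-- for the Heisenberg minimal surface generated by
`Γ(s) = (-2 cos s, -2 sin s, cos s, s)`:
(a) `q(t,s) = ((t-2) cos s, (t-2) sin s, cos s)`, so `q(2,s) = (0,0,cos s)` and the
surface intersects itself along the segment `{(0,0,z) : -1 ≤ z ≤ 1}` joining
`q(2,0) = (0,0,1)` and `q(2,π) = (0,0,-1)`;
(b) the frame components of `Γ'` are `ξ1 = 2 sin s`, `ξ2 = -2 cos s`, `ξ3 = -2 - sin s`,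
`ξ4 = 1`, and the discriminant `D(s) = (ξ1 sin s - ξ2 cos s)² + 2 ξ3 ξ4 = -2 sin s`;
(c) the parametrization has rank `< 2` iff `t = 2` and `sin s = 0`, so the singular
characteristic points are exactly `(0,0,1)` and `(0,0,-1)`. -/
theorem example4_singular_set :
    (∀ t s : ℝ, ex4Surf t s
      = ![(t - 2) * Real.cos s, (t - 2) * Real.sin s, Real.cos s]) ∧
    (∀ s : ℝ, ex4Surf 2 s = ![0, 0, Real.cos s]) ∧
    (∀ s : ℝ, ex4Surf 2 s = ex4Surf 2 (-s)) ∧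
    (∀ z : ℝ, -1 ≤ z → z ≤ 1 → ∃ s : ℝ, ex4Surf 2 s = ![0, 0, z]) ∧
    (ex4Surf 2 0 = ![0, 0, 1] ∧ ex4Surf 2 Real.pi = ![0, 0, -1]) ∧
    (∀ s : ℝ,
      deriv (fun u => -2 * Real.cos u) s = 2 * Real.sin s ∧
      deriv (fun u => -2 * Real.sin u) s = -2 * Real.cos s ∧
      deriv (fun u => Real.cos u) s
        - ((-2 * Real.cos s) * deriv (fun u => -2 * Real.sin u) s
            - (-2 * Real.sin s) * deriv (fun u => -2 * Real.cos u) s) / 2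
        = -2 - Real.sin s ∧
      deriv (id : ℝ → ℝ) s = 1 ∧
      ((2 * Real.sin s) * Real.sin s - (-2 * Real.cos s) * Real.cos s)^2
        + 2 * (-2 - Real.sin s) * 1 = -2 * Real.sin s) ∧
    (∀ t s : ℝ,
      (¬ LinearIndependent ℝ
        ![(fun i => deriv (fun u => ex4Surf u s i) t),
          (fun i => deriv (fun u => ex4Surf t u i) s)]) ↔ (t = 2 ∧ Real.sin s = 0)) ∧
    (∀ t s : ℝ,
      (¬ LinearIndependent ℝ
        ![(fun i => deriv (fun u => ex4Surf u s i) t),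
          (fun i => deriv (fun u => ex4Surf t u i) s)]) →
      (ex4Surf t s = ![0, 0, 1] ∨ ex4Surf t s = ![0, 0, -1])) := by
  refine ⟨ex4Surf_apply, fun s => by simp [ex4Surf_apply], fun s => by simp [ex4Surf_apply],
    fun z hz hz' => ⟨Real.arccos z, by simp [ex4Surf_apply, Real.cos_arccos hz hz']⟩,
    ⟨by simp [ex4Surf_apply], by simp [ex4Surf_apply]⟩, fun s => ?_,
    ex4Surf_not_linearIndependent_iff, fun t s h => ?_⟩
  · have hsc := Real.sin_sq_add_cos_sq s
    have hx : deriv (fun u => -2 * Real.cos u) s = 2 * Real.sin s := by simp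
    have hy : deriv (fun u => -2 * Real.sin u) s = -2 * Real.cos s := by simp
    have hz : deriv (fun u => Real.cos u) s = -Real.sin s := by simp
    refine ⟨hx, hy, ?_, deriv_id s, ?_⟩
    · rw [hx, hy, hz]
      linear_combination -2 * hsc
    · linear_combination 4 * (Real.sin s ^ 2 + Real.cos s ^ 2 + 1) * hsc
  · obtain ⟨rfl, hs⟩ := (ex4Surf_not_linearIndependent_iff t s).1 h
    rcases Real.sin_eq_zero_iff_cos_eq.1 hs with hc | hc
    · exact .inl (by simp [ex4Surf_apply, hc])
    · exact .inr (by simp [ex4Surf_apply, hc])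
end
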